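/- Let G ⊆ F2^24 be a binary self-dual doubly-even linear code with minimum nonzero weight 8, and let g' ∈ S_24 be the permutation that is the product of the eight disjoint 3-cycles (3k+1, 3k+2, 3k+3) for k = 0,…,7. Assume g' ∈ Aut(G). Define D0 := {a ∈ F2^8 : r3(a) ∈ G}, where r3(a) ∈ F2^24 is the vector whose entry at position 3k+j (k = 0,…,7, j = 1,2,3) equals a_{k+1}. Then D0 is a self-dual doubly-even binary code of dimension 4 with minimum nonzero weight 4 (i.e., D0 has the parameters of the extended Hamming code of length 8). -/

import Mathlib

/-- The Hamming weight of a binary vector: the number of nonzero coordinates. -/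
def wt {n : ℕ} (c : Fin n → ZMod 2) : ℕ := (Finset.univ.filter fun i => c i ≠ 0).card

/-- The standard inner product on `F2^n`. -/
def inner2 {n : ℕ} (v w : Fin n → ZMod 2) : ZMod 2 := ∑ i, v i * w i

/-- A binary code is self-dual if it equals its dual with respect to the
standard inner product. -/
def IsSelfDual {n : ℕ} (C : Submodule (ZMod 2) (Fin n → ZMod 2)) : Prop :=
  (C : Set (Fin n → ZMod 2)) = {v | ∀ c ∈ C, inner2 v c = 0}

/-- A binary code is doubly even if every codeword has weight divisible by 4. -/
def IsDoublyEven {n : ℕ} (C : Submodule (ZMod 2) (Fin n → ZMod 2)) : Prop :=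
  ∀ c ∈ C, 4 ∣ wt c

/-- The permutation of `{1,…,24}` that is the product of the eight disjoint
3-cycles `(3k+1, 3k+2, 3k+3)`, written 0-indexed on `Fin 24`. -/
def g3' : Equiv.Perm (Fin 24) where
  toFun i := ⟨3 * (i.val / 3) + ((i.val % 3 + 1) % 3), by have := i.isLt; omega⟩
  invFun i := ⟨3 * (i.val / 3) + ((i.val % 3 + 2) % 3), by have := i.isLt; omega⟩
  left_inv := by decide
  right_inv := by decide

/-- The 3-fold repetition map `F2^8 → F2^24`: the entry of `r3' a` at position
`3k+j` (`j = 1,2,3`) equals `a_{k+1}`. -/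
def r3' : (Fin 8 → ZMod 2) →ₗ[ZMod 2] (Fin 24 → ZMod 2) where
  toFun a := fun i => a ⟨i.val / 3, by have := i.isLt; omega⟩
  map_add' := fun _ _ => rfl
  map_smul' := fun _ _ => rfl

lemma aux_sum24 {M : Type*} [AddCommMonoid M] (f : Fin 24 → M) :
    ∑ i, f i = ∑ k : Fin 8, (f ⟨3 * k.val, by omega⟩ + f ⟨3 * k.val + 1, by omega⟩
      + f ⟨3 * k.val + 2, by omega⟩) := by
  simp [Fin.sum_univ_succ, Fin.succ, add_assoc]

lemma aux_wt_sum {n : ℕ} (c : Fin n → ZMod 2) : wt c = ∑ i, if c i ≠ 0 then 1 else 0 := by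
  simp [wt, Finset.card_filter]

lemma aux_r0 (a : Fin 8 → ZMod 2) (k : Fin 8) : r3' a ⟨3 * k.val, by omega⟩ = a k := by
  simp only [r3', LinearMap.coe_mk, AddHom.coe_mk]; congr 1; ext; simp
lemma aux_r1 (a : Fin 8 → ZMod 2) (k : Fin 8) : r3' a ⟨3 * k.val + 1, by omega⟩ = a k := by
  simp only [r3', LinearMap.coe_mk, AddHom.coe_mk]; congr 1; ext; simp; omega
lemma aux_r2 (a : Fin 8 → ZMod 2) (k : Fin 8) : r3' a ⟨3 * k.val + 2, by omega⟩ = a k := by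
  simp only [r3', LinearMap.coe_mk, AddHom.coe_mk]; congr 1; ext; simp; omega

lemma aux_wt_r (a : Fin 8 → ZMod 2) : wt (r3' a) = 3 * wt a := by
  rw [aux_wt_sum, aux_wt_sum, aux_sum24, Finset.mul_sum]
  refine Finset.sum_congr rfl fun k _ => ?_
  rw [aux_r0, aux_r1, aux_r2]; split_ifs <;> rfl

/-- The map summing each block of three coordinates. -/
def auxPi (c : Fin 24 → ZMod 2) : Fin 8 → ZMod 2 := fun k =>
  c ⟨3 * k.val, by omega⟩ + c ⟨3 * k.val + 1, by omega⟩ + c ⟨3 * k.val + 2, by omega⟩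

lemma aux_inner (a : Fin 8 → ZMod 2) (c : Fin 24 → ZMod 2) :
    inner2 (r3' a) c = inner2 a (auxPi c) := by
  unfold inner2
  rw [aux_sum24]
  refine Finset.sum_congr rfl fun k _ => ?_
  rw [aux_r0, aux_r1, aux_r2, auxPi]; ring

lemma aux_pi_r (a : Fin 8 → ZMod 2) : auxPi (r3' a) = a := by
  funext k
  rw [auxPi, aux_r0, aux_r1, aux_r2]
  generalize a k = x
  revert x; decide

lemma aux_r_pi (c : Fin 24 → ZMod 2) :
    r3' (auxPi c) = c + c ∘ ⇑g3' + (c ∘ ⇑g3') ∘ ⇑g3' := by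
  funext i
  fin_cases i <;> simp [r3', auxPi, g3'] <;> ring

lemma aux_finrank (C : Submodule (ZMod 2) (Fin 8 → ZMod 2)) (h : IsSelfDual C) :
    Module.finrank (ZMod 2) C = 4 := by
  let B : LinearMap.BilinForm (ZMod 2) (Fin 8 → ZMod 2) := Matrix.toBilin' 1
  have hB : ∀ v w, B v w = inner2 v w := fun v w => by
    simp [B, Matrix.toBilin'_apply', inner2, dotProduct]
  have hcomm : ∀ v w : Fin 8 → ZMod 2, inner2 v w = inner2 w v := fun v w => by
    simp [inner2, mul_comm]
  have hnd : B.Nondegenerate := by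
    apply LinearMap.BilinForm.nondegenerate_toBilin'_of_det_ne_zero'
    simp
  have hrefl : B.IsRefl := fun v w hvw => by
    rw [hB] at *; rw [hcomm]; exact hvw
  have horth : B.orthogonal C = C := by
    ext v
    have hv : v ∈ C ↔ ∀ c ∈ C, inner2 v c = 0 := by
      rw [← SetLike.mem_coe, h]
      have h' := h
      unfold IsSelfDual at h'
      simp only [Set.mem_ofPred_eq]
    rw [hv, LinearMap.BilinForm.mem_orthogonal_iff]
    refine forall₂_congr fun c _ => ?_
    rw [hB, hcomm]
  have := LinearMap.BilinForm.finrank_orthogonal hnd C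
  rw [horth] at this
  have hle := Submodule.finrank_le C
  simp at this hle
  omega

/-- For a self-dual doubly-even `[24,12,8]` code `G` (the parameters of the
extended binary Golay code) invariant under the fixed-point free permutation
`g3'` of order 3, the code `D0 = {a ∈ F2^8 : r3' a ∈ G}` is a self-dual
doubly-even `[8,4,4]` code (the parameters of the extended Hamming code). -/
theorem fixed_code_of_golay_is_hamming (G : Submodule (ZMod 2) (Fin 24 → ZMod 2))
    (hsd : IsSelfDual G)
    (hde : IsDoublyEven G)
    (hmin : ∀ c ∈ G, c ≠ 0 → 8 ≤ wt c)
    (hex : ∃ c ∈ G, wt c = 8)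
    (hg : (fun c => c ∘ ⇑g3') '' (G : Set (Fin 24 → ZMod 2)) = G) :
    IsSelfDual (G.comap r3') ∧
    IsDoublyEven (G.comap r3') ∧
    Module.finrank (ZMod 2) (G.comap r3') = 4 ∧
    (∀ a ∈ G.comap r3', a ≠ 0 → 4 ≤ wt a) ∧
    (∃ a ∈ G.comap r3', wt a = 4) := by
  have hmem : ∀ v, v ∈ G ↔ ∀ c ∈ G, inner2 v c = 0 := fun v => by
    have := Set.ext_iff.mp hsd v
    simpa using this
  have hgc : ∀ c ∈ G, c ∘ ⇑g3' ∈ G := fun c hc => by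
    have : c ∘ ⇑g3' ∈ (G : Set (Fin 24 → ZMod 2)) := by
      rw [← hg]; exact ⟨c, hc, rfl⟩
    exact this
  have hpi : ∀ c ∈ G, auxPi c ∈ G.comap r3' := fun c hc => by
    rw [Submodule.mem_comap, aux_r_pi]
    exact G.add_mem (G.add_mem hc (hgc c hc)) (hgc _ (hgc c hc))
  have h1 : IsSelfDual (G.comap r3') := by
    ext a
    simp only [SetLike.mem_coe, Set.mem_ofPred_eq]
    constructor
    · intro ha b hb
      have := (hmem _).1 (Submodule.mem_comap.1 ha) _ (Submodule.mem_comap.1 hb)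
      rwa [aux_inner, aux_pi_r] at this
    · intro ha
      rw [Submodule.mem_comap, hmem]
      intro c hc
      rw [aux_inner]
      exact ha _ (hpi c hc)
  have h2 : IsDoublyEven (G.comap r3') := fun a ha => by
    have := hde _ (Submodule.mem_comap.1 ha)
    rw [aux_wt_r] at this
    omega
  have h3 := aux_finrank _ h1
  have h4 : ∀ a ∈ G.comap r3', a ≠ 0 → 4 ≤ wt a := fun a ha h0 => by
    have hd := h2 a ha
    have : wt a ≠ 0 := fun hw => h0 <| by
      funext i
      by_contra hi
      have hm : i ∈ Finset.univ.filter fun i => a i ≠ 0 := by simpa using hi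
      rw [Finset.card_eq_zero.1 hw] at hm
      simp at hm
    omega
  refine ⟨h1, h2, h3, h4, ?_⟩
  by_contra! hno
  have hle : G.comap r3' ≤ Submodule.span (ZMod 2) {fun _ => 1} := fun a ha => by
    by_cases h0 : a = 0
    · rw [h0]; exact Submodule.zero_mem _
    have hw8 : wt a ≤ 8 := by simpa [wt] using Finset.card_filter_le Finset.univ fun i => a i ≠ 0
    have e1 := h2 a ha
    have e2 := h4 a ha h0
    have e3 := hno a ha
    have e4 : wt a = 8 := by omega
    have e5 : (Finset.univ.filter fun i => a i ≠ 0) = Finset.univ :=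
      Finset.eq_univ_of_card _ (by simpa [wt] using e4)
    have e6 : a = fun _ => 1 := by
      funext i
      have hm : i ∈ Finset.univ.filter fun i => a i ≠ 0 := by
        rw [e5]; exact Finset.mem_univ i
      have hi : a i ≠ 0 := by simpa using hm
      clear hm
      generalize a i = x at hi
      revert x; decide
    rw [e6]
    exact Submodule.mem_span_singleton_self _
  have l1 := Submodule.finrank_mono hle
  have l2 := finrank_span_singleton (K := ZMod 2) (v := (fun _ => 1 : Fin 8 → ZMod 2))
    (fun h => by simpa using congrFun h 0)
  omega
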